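/- For every n ≥ 1 and all σ, σ', λ, λ' > 0, the derivative of the mismatched free energy with respect to the assumed SNR λ' satisfies (d/dλ') f_n = (1/4)·(1/n²)·E[ ‖⟨x xᵀ⟩_{λ',σ'}‖_F² − √(λ/λ')·⟨(sᵀx)²⟩_{λ',σ'} ]. -/

import Mathlib

open MeasureTheory ProbabilityTheory Filter Matrix

noncomputable section

instance {n : ℕ} : MeasurableSpace (Matrix (Fin n) (Fin n) ℝ) :=
  inferInstanceAs (MeasurableSpace (Fin n → Fin n → ℝ))

/-- Squared Frobenius norm of a matrix. -/
def frobSq {n : ℕ} (M : Matrix (Fin n) (Fin n) ℝ) : ℝ := ∑ i, ∑ j, (M i j) ^ 2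

/-- i.i.d. centered Gaussian prior with variance `v` on `ℝⁿ`. -/
def gaussPrior (n : ℕ) (v : ℝ) : Measure (Fin n → ℝ) :=
  Measure.pi fun _ => gaussianReal 0 (Real.toNNReal v)

/-- Law of the symmetric noise matrix `Z`: independent `N(0,1)` entries above the
diagonal and `N(0,2)` entries on the diagonal, extended symmetrically. -/
def noiseMeasure (n : ℕ) : Measure (Matrix (Fin n) (Fin n) ℝ) :=
  (Measure.pi fun p : Fin n × Fin n =>
      gaussianReal 0 (if p.1 = p.2 then 2 else 1)).map
    (fun g => Matrix.of fun i j => if i ≤ j then g (i, j) else g (j, i))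

/-- Observation matrix `Y = √(λ/n) s sᵀ + Z`. -/
def obs (n : ℕ) (lam : ℝ) (s : Fin n → ℝ) (Z : Matrix (Fin n) (Fin n) ℝ) :
    Matrix (Fin n) (Fin n) ℝ :=
  Real.sqrt (lam / n) • Matrix.vecMulVec s s + Z

/-- Posterior weight `exp(−¼‖Y−√(λ'/n) x xᵀ‖_F²)`. -/
def weight (n : ℕ) (lam' : ℝ) (Y : Matrix (Fin n) (Fin n) ℝ) (x : Fin n → ℝ) : ℝ :=
  Real.exp (-(1 / 4) * frobSq (Y - Real.sqrt (lam' / n) • Matrix.vecMulVec x x))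

/-- Gibbs (mismatched posterior) average `⟨f(x)⟩_{λ',σ'}` of an observable `f`. -/
def gibbs (n : ℕ) (sig' lam' : ℝ) (Y : Matrix (Fin n) (Fin n) ℝ)
    (f : (Fin n → ℝ) → ℝ) : ℝ :=
  (∫ x, f x * weight n lam' Y x ∂gaussPrior n (sig' ^ 2)) /
    (∫ x, weight n lam' Y x ∂gaussPrior n (sig' ^ 2))

/-- Posterior mean matrix `⟨x xᵀ⟩_{λ',σ'}`. -/
def gibbsMatrix (n : ℕ) (sig' lam' : ℝ) (Y : Matrix (Fin n) (Fin n) ℝ) :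
    Matrix (Fin n) (Fin n) ℝ :=
  Matrix.of fun i j => gibbs n sig' lam' Y (fun x => x i * x j)

/-- Mismatched matrix-MSE `MSE_n(σ,σ',λ,λ')`. -/
def MSE (n : ℕ) (sig sig' lam lam' : ℝ) : ℝ :=
  (1 / (n : ℝ) ^ 2) *
    ∫ p, frobSq (Matrix.vecMulVec p.1 p.1 -
        gibbsMatrix n sig' lam' (obs n lam p.1 p.2))
      ∂((gaussPrior n (sig ^ 2)).prod (noiseMeasure n))

/-- Partition function `Z(Y)`. -/
def partitionFn (n : ℕ) (sig' lam' : ℝ) (Y : Matrix (Fin n) (Fin n) ℝ) : ℝ :=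
  ∫ x, Real.exp (-(lam' / (4 * n)) * (∑ i, (x i) ^ 2) ^ 2 +
      (1 / 2) * Real.sqrt (lam' / n) * Matrix.trace (Y * Matrix.vecMulVec x x))
    ∂gaussPrior n (sig' ^ 2)

/-- Mismatched free energy `f_n = −(1/n) E[ln Z(Y)]`. -/
def freeEnergy (n : ℕ) (sig sig' lam lam' : ℝ) : ℝ :=
  -(1 / (n : ℝ)) *
    ∫ p, Real.log (partitionFn n sig' lam' (obs n lam p.1 p.2))
      ∂((gaussPrior n (sig ^ 2)).prod (noiseMeasure n))


theorem stein1d (v : NNReal) (hv : v ≠ 0) (f f' : ℝ → ℝ)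
    (hd : ∀ u, HasDerivAt f (f' u) u)
    (h0 : Integrable f (gaussianReal 0 v)) (h1 : Integrable f' (gaussianReal 0 v))
    (h2 : Integrable (fun u => u * f u) (gaussianReal 0 v)) :
    ∫ u, u * f u ∂(gaussianReal 0 v) = v * ∫ u, f' u ∂(gaussianReal 0 v) := by
  have conv : ∀ g : ℝ → ℝ, Integrable g (gaussianReal 0 v) →
      Integrable (fun u => gaussianPDFReal 0 v u * g u) := by
    intro g hg
    rw [gaussianReal_of_var_ne_zero 0 hv] at hg
    have := (integrable_withDensity_iff_integrable_smul' (measurable_gaussianPDF 0 v)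
      (Eventually.of_forall fun _ => gaussianPDF_lt_top)).1 hg
    simpa [toReal_gaussianPDF] using this
  have hv' : (v : ℝ) ≠ 0 := by exact_mod_cast hv
  have dpdf : ∀ u, HasDerivAt (gaussianPDFReal 0 v) (-(u / v) * gaussianPDFReal 0 v u) u := by
    intro u
    unfold gaussianPDFReal
    have h := (((hasDerivAt_id u).sub_const 0).pow 2).neg.div_const (2 * (v : ℝ))
    have h' := (h.exp).const_mul ((√(2 * Real.pi * v))⁻¹)
    refine h'.congr_deriv ?_
    simp
    field_simp
  rw [integral_gaussianReal_eq_integral_smul hv, integral_gaussianReal_eq_integral_smul hv]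
  simp only [smul_eq_mul]
  have key := integral_mul_deriv_eq_deriv_mul_of_integrable (u := f) (u' := f')
    (v := gaussianPDFReal 0 v) (v' := fun u => -(u / v) * gaussianPDFReal 0 v u)
    (fun x _ => hd x) (fun x _ => dpdf x)
    (by
      refine ((conv _ h2).const_mul (-(1 / (v : ℝ)))).congr (Eventually.of_forall fun u => ?_)
      simp; ring)
    (by
      refine (conv _ h1).congr (Eventually.of_forall fun u => ?_)
      simp; ring)
    (by
      refine (conv _ h0).congr (Eventually.of_forall fun u => ?_)
      simp; ring)
  have e1 : ∫ u, gaussianPDFReal 0 v u * (u * f u)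
      = -(v : ℝ) * ∫ u, f u * (-(u / v) * gaussianPDFReal 0 v u) := by
    rw [← integral_const_mul]
    congr 1; ext u; field_simp
  rw [e1, key]
  simp only [mul_comm (f' _)]
  ring

theorem stein_abs {Ω : Type*} [MeasurableSpace Ω] (P : Measure Ω) [IsProbabilityMeasure P]
    (v : NNReal) (hv : v ≠ 0) (T : Ω × ℝ → Ω)
    (hT : MeasurePreserving T (P.prod (gaussianReal 0 v)) P)
    (l F F' : Ω → ℝ) (hl : ∀ ω u, l (T (ω, u)) = u)
    (hd : ∀ ω u, HasDerivAt (fun u => F (T (ω, u))) (F' (T (ω, u))) u)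
    (h0 : Integrable F P) (h1 : Integrable F' P) (h2 : Integrable (fun ω => l ω * F ω) P) :
    ∫ ω, l ω * F ω ∂P = v * ∫ ω, F' ω ∂P := by
  have tr : ∀ g : Ω → ℝ, Integrable g P → ∫ ω, g ω ∂P
      = ∫ ω, ∫ u, g (T (ω, u)) ∂(gaussianReal 0 v) ∂P := by
    intro g hg
    have hg' : Integrable (fun z => g (T z)) (P.prod (gaussianReal 0 v)) :=
      hT.integrable_comp_of_integrable hg
    rw [← integral_prod (fun z => g (T z)) hg']
    have := integral_map (μ := P.prod (gaussianReal 0 v)) hT.measurable.aemeasurable (f := g)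
      (by rw [hT.map_eq]; exact hg.1)
    rw [hT.map_eq] at this
    exact this
  rw [tr _ h1, tr _ h2, ← integral_const_mul]
  have i0 := (hT.integrable_comp_of_integrable h0).prod_right_ae
  have i1 := (hT.integrable_comp_of_integrable h1).prod_right_ae
  have i2 := (hT.integrable_comp_of_integrable h2).prod_right_ae
  apply integral_congr_ae
  filter_upwards [i0, i1, i2] with ω a0 a1 a2
  simp only [Function.comp, hl] at a0 a1 a2 ⊢
  exact stein1d v hv _ _ (hd ω) a0 a1 a2

theorem mp_update {ι : Type*} [Fintype ι] [DecidableEq ι] (m : ι → Measure ℝ)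
    [∀ i, IsProbabilityMeasure (m i)] (k : ι) :
    MeasurePreserving (fun z : (ι → ℝ) × ℝ => Function.update z.1 k z.2)
      ((Measure.pi m).prod (m k)) (Measure.pi m) := by
  have hm : Measurable (fun z : (ι → ℝ) × ℝ => Function.update z.1 k z.2) := by
    rw [measurable_pi_iff]
    intro i
    by_cases h : i = k
    · subst h; simpa using measurable_snd
    · simp only [Function.update_of_ne h]; fun_prop
  refine ⟨hm, ?_⟩
  symm
  apply Measure.pi_eq
  intro s hs
  rw [Measure.map_apply hm (MeasurableSet.univ_pi hs)]
  have : (fun z : (ι → ℝ) × ℝ => Function.update z.1 k z.2) ⁻¹' (Set.univ.pi s)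
      = (Set.univ.pi (Function.update s k Set.univ)) ×ˢ (s k) := by
    ext z
    simp only [Set.mem_preimage, Set.mem_univ_pi, Set.mem_prod]
    constructor
    · intro h
      refine ⟨fun i => ?_, by simpa using h k⟩
      by_cases hi : i = k
      · subst hi; simp
      · simpa [hi] using h i
    · rintro ⟨h, h'⟩ i
      by_cases hi : i = k
      · subst hi; simpa
      · simpa [hi] using h i
  rw [this, Measure.prod_prod, Measure.pi_pi, ← Finset.mul_prod_erase _ _ (Finset.mem_univ k),
    ← Finset.mul_prod_erase (a := k) Finset.univ (fun i => m i (s i)) (Finset.mem_univ k)]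
  simp only [Function.update_self, measure_univ, one_mul]
  rw [mul_comm]
  congr 1
  apply Finset.prod_congr rfl
  intro i hi
  rw [Function.update_of_ne (Finset.ne_of_mem_erase hi)]

theorem mp_update2 {ι S : Type*} [Fintype ι] [DecidableEq ι] [MeasurableSpace S]
    (ν : Measure S) [IsProbabilityMeasure ν] (m : ι → Measure ℝ)
    [∀ i, IsProbabilityMeasure (m i)] (k : ι) :
    MeasurePreserving (fun z : (S × (ι → ℝ)) × ℝ => (z.1.1, Function.update z.1.2 k z.2))
      ((ν.prod (Measure.pi m)).prod (m k)) (ν.prod (Measure.pi m)) :=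
  ((MeasurePreserving.id ν).prod (mp_update m k)).comp
    (measurePreserving_prodAssoc ν (Measure.pi m) (m k))

/-- All polynomial moments. -/
def Mom {Ω : Type*} [MeasurableSpace Ω] (P : Measure Ω) (f : Ω → ℝ) : Prop :=
  AEStronglyMeasurable f P ∧ ∀ k : ℕ, Integrable (fun ω => |f ω| ^ k) P

section mom
set_option linter.unusedSectionVars false
variable {Ω : Type*} [MeasurableSpace Ω] {P : Measure Ω} [IsProbabilityMeasure P]

theorem Mom.integrable {f : Ω → ℝ} (h : Mom P f) : Integrable f P := by
  have := h.2 1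
  simp only [pow_one] at this
  exact (integrable_norm_iff h.1).1 this

theorem Mom.mono {f g : Ω → ℝ} (h : Mom P f) (hg : AEStronglyMeasurable g P)
    (hb : ∀ ω, |g ω| ≤ |f ω|) : Mom P g := by
  refine ⟨hg, fun k => (h.2 k).mono' (hg.norm.pow k) (Eventually.of_forall fun ω => ?_)⟩
  simp only [norm_pow, Real.norm_eq_abs, abs_abs]
  exact pow_le_pow_left₀ (abs_nonneg _) (hb ω) k

theorem Mom.const (c : ℝ) : Mom P (fun _ => c) :=
  ⟨aestronglyMeasurable_const, fun k => integrable_const _⟩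

theorem Mom.add {f g : Ω → ℝ} (hf : Mom P f) (hg : Mom P g) : Mom P (fun ω => f ω + g ω) := by
  refine ⟨hf.1.add hg.1, fun k => ?_⟩
  refine (((hf.2 k).add (hg.2 k)).const_mul (2 ^ (k - 1))).mono' ((hf.1.add hg.1).norm.pow k)
    (Eventually.of_forall fun ω => ?_)
  simp only [norm_pow, Real.norm_eq_abs, abs_abs]
  calc |f ω + g ω| ^ k ≤ (|f ω| + |g ω|) ^ k :=
        pow_le_pow_left₀ (abs_nonneg _) (abs_add_le _ _) k
    _ ≤ _ := add_pow_le (abs_nonneg _) (abs_nonneg _) k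

theorem Mom.mul {f g : Ω → ℝ} (hf : Mom P f) (hg : Mom P g) : Mom P (fun ω => f ω * g ω) := by
  refine ⟨hf.1.mul hg.1, fun k => ?_⟩
  refine ((hf.2 (k * 2)).add (hg.2 (k * 2))).mono' ((hf.1.mul hg.1).norm.pow k)
    (Eventually.of_forall fun ω => ?_)
  simp only [norm_pow, Real.norm_eq_abs, abs_abs, Pi.add_apply, abs_mul, mul_pow, pow_mul, abs_pow]
  nlinarith [sq_nonneg (|f ω| ^ k - |g ω| ^ k), sq_nonneg (|f ω| ^ k), sq_nonneg (|g ω| ^ k)]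

theorem Mom.sum {ι : Type*} (s : Finset ι) {f : ι → Ω → ℝ} (hf : ∀ i, Mom P (f i)) :
    Mom P (fun ω => ∑ i ∈ s, f i ω) := by
  classical
  induction s using Finset.induction_on with
  | empty => simpa using Mom.const 0
  | insert a s ha ih => simp only [Finset.sum_insert ha]; exact (hf a).add ih

theorem Mom.abs {f : Ω → ℝ} (hf : Mom P f) : Mom P (fun ω => |f ω|) :=
  hf.mono hf.1.norm (fun ω => by simp)

theorem Mom.pow {f : Ω → ℝ} (hf : Mom P f) (k : ℕ) : Mom P (fun ω => f ω ^ k) := by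
  induction k with
  | zero => simpa using Mom.const 1
  | succ k ih => simp only [pow_succ]; exact ih.mul hf

theorem Mom.comp {Ω' : Type*} [MeasurableSpace Ω'] {P' : Measure Ω'} {f : Ω → ℝ} (hf : Mom P f)
    {T : Ω' → Ω} (hT : MeasurePreserving T P' P) : Mom P' (fun ω => f (T ω)) :=
  ⟨hf.1.comp_measurePreserving hT, fun k => hT.integrable_comp_of_integrable (hf.2 k)⟩
end mom

theorem mom_gauss (v : NNReal) : Mom (gaussianReal 0 v) (fun u => u) := by
  refine ⟨measurable_id.aestronglyMeasurable, fun k => ?_⟩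
  have := memLp_id_gaussianReal' (μ := 0) (v := v) (k : ENNReal) (by simp)
  simpa using this.integrable_norm_pow'

theorem mom_pi {ι : Type*} [Fintype ι] (v : ι → NNReal) (i : ι) :
    Mom (Measure.pi fun i => gaussianReal 0 (v i)) (fun g => g i) :=
  (mom_gauss (v i)).comp (measurePreserving_eval (fun i => gaussianReal 0 (v i)) i)


section gibbsAbs
set_option linter.unusedSectionVars false
variable {X : Type*} [MeasurableSpace X] (μ : Measure X) [IsProbabilityMeasure μ] (r : X → ℝ)

def ew (r : X → ℝ) (b : ℝ) (Q : X → ℝ) (x : X) : ℝ :=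
  Real.exp (-(b ^ 2 * r x ^ 2) / 4 + b * Q x / 2)

def NN (μ : Measure X) (r : X → ℝ) (b : ℝ) (Q f : X → ℝ) : ℝ := ∫ x, f x * ew r b Q x ∂μ

def ZZ (μ : Measure X) (r : X → ℝ) (b : ℝ) (Q : X → ℝ) : ℝ := ∫ x, ew r b Q x ∂μ

def GG (μ : Measure X) (r : X → ℝ) (b : ℝ) (Q f : X → ℝ) : ℝ := NN μ r b Q f / ZZ μ r b Q

variable {μ r}

theorem ew_pos (b : ℝ) (Q : X → ℝ) (x : X) : 0 < ew r b Q x := Real.exp_pos _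

theorem ew_le {b M : ℝ} {Q : X → ℝ} {x : X} (hQ : |Q x| ≤ M * r x) :
    ew r b Q x ≤ Real.exp (M ^ 2 / 4) := by
  apply Real.exp_le_exp.2
  have h1 : b * Q x ≤ |b| * (M * r x) := by
    calc b * Q x ≤ |b * Q x| := le_abs_self _
      _ = |b| * |Q x| := abs_mul _ _
      _ ≤ _ := mul_le_mul_of_nonneg_left hQ (abs_nonneg _)
  have h2 : b ^ 2 = |b| ^ 2 := (sq_abs b).symm
  rw [h2]
  nlinarith [sq_nonneg (|b| * r x - M)]

theorem ew_meas (hr : Measurable r) {Q : X → ℝ} (hQ : Measurable Q) (b : ℝ) :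
    Measurable (ew r b Q) := by
  unfold ew
  fun_prop

theorem int_N (hr : Measurable r) {Q : X → ℝ} (hQ : Measurable Q) {b M : ℝ}
    (hM : ∀ x, |Q x| ≤ M * r x) {f : X → ℝ} (hf : Integrable f μ) :
    Integrable (fun x => f x * ew r b Q x) μ := by
  refine (hf.norm.mul_const (Real.exp (M ^ 2 / 4))).mono'
    (hf.1.mul (ew_meas hr hQ b).aestronglyMeasurable) (Eventually.of_forall fun x => ?_)
  rw [norm_mul, Real.norm_of_nonneg (ew_pos b Q x).le]
  exact mul_le_mul_of_nonneg_left (ew_le (hM x)) (norm_nonneg _)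

theorem int_Z (hr : Measurable r) {Q : X → ℝ} (hQ : Measurable Q) {b M : ℝ}
    (hM : ∀ x, |Q x| ≤ M * r x) : Integrable (ew r b Q) μ := by
  simpa using int_N (b := b) hr hQ hM (integrable_const (1 : ℝ) : Integrable (fun _ => (1 : ℝ)) μ)

theorem ZZ_pos (hr : Measurable r) {Q : X → ℝ} (hQ : Measurable Q) {b M : ℝ}
    (hM : ∀ x, |Q x| ≤ M * r x) : 0 < ZZ μ r b Q :=
  integral_exp_pos (int_Z hr hQ hM)

theorem NN_one (b : ℝ) (Q : X → ℝ) : NN μ r b Q (fun _ => 1) = ZZ μ r b Q := by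
  simp [NN, ZZ]

theorem deriv_b (hr : Measurable r) (hmr : Mom μ r) {Q : X → ℝ}
    (hQ : Measurable Q) {b M : ℝ} (hM : ∀ x, |Q x| ≤ M * r x) :
    HasDerivAt (fun b => ZZ μ r b Q) (NN μ r b Q (fun x => -(b / 2) * r x ^ 2 + Q x / 2)) b := by
  have hQi : Integrable Q μ := (hmr.integrable.const_mul M).mono' hQ.aestronglyMeasurable
    (Eventually.of_forall hM)
  have hr2 := (hmr.pow 2).integrable
  refine (hasDerivAt_integral_of_dominated_loc_of_deriv_le (μ := μ)
    (F := fun b x => ew r b Q x)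
    (F' := fun b x => (-(b / 2) * r x ^ 2 + Q x / 2) * ew r b Q x)
    (bound := fun x => ((|b| + 1) / 2 * r x ^ 2 + |Q x| / 2) * Real.exp (M ^ 2 / 4))
    (Metric.ball_mem_nhds b one_pos) ?_ (int_Z hr hQ hM) ?_ ?_ ?_ ?_).2
  · exact Eventually.of_forall fun b => (ew_meas hr hQ b).aestronglyMeasurable
  · have := ew_meas hr hQ b
    exact Measurable.aestronglyMeasurable (by fun_prop)
  · refine Eventually.of_forall fun x c hc => ?_
    rw [norm_mul, Real.norm_of_nonneg (ew_pos c Q x).le]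
    have hc' : |c| ≤ |b| + 1 := by
      rw [Metric.mem_ball, Real.dist_eq] at hc
      have := abs_sub_abs_le_abs_sub c b
      linarith
    refine mul_le_mul ?_ (ew_le (hM x)) (ew_pos c Q x).le (by positivity)
    rw [Real.norm_eq_abs]
    refine (abs_add_le _ _).trans ?_
    rw [abs_mul, abs_neg, abs_div, abs_div, abs_of_nonneg (sq_nonneg (r x)), abs_two]
    gcongr
  · exact (((hr2.const_mul _).add (hQi.norm.div_const 2))).mul_const _
  · refine Eventually.of_forall fun x c _ => ?_
    unfold ew
    have h1 := ((((hasDerivAt_id c).pow 2).mul_const (r x ^ 2)).neg.div_const 4).add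
      (((hasDerivAt_id c).mul_const (Q x)).div_const 2)
    refine h1.exp.congr_deriv ?_
    simp
    ring

theorem deriv_u (hr : Measurable r) (hr0 : ∀ x, 0 ≤ r x) {Q D f : X → ℝ}
    (hQ : Measurable Q) (hD : Measurable D) {b M L : ℝ} (hM : ∀ x, |Q x| ≤ M * r x)
    (hL : ∀ x, |D x| ≤ L * r x) (hL0 : 0 ≤ L) (hf : Integrable f μ)
    (hfD : Integrable (fun x => f x * D x) μ) (u : ℝ) :
    HasDerivAt (fun u => NN μ r b (fun x => Q x + u * D x) f)
      (NN μ r b (fun x => Q x + u * D x) (fun x => (b / 2) * (f x * D x))) u := by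
  have hb : ∀ c x, |c| ≤ |u| + 1 → |Q x + c * D x| ≤ (M + (|u| + 1) * L) * r x := by
    intro c x hc
    calc |Q x + c * D x| ≤ |Q x| + |c| * |D x| := by
          rw [← abs_mul]; exact abs_add_le _ _
      _ ≤ M * r x + (|u| + 1) * (L * r x) := by
          have := hr0 x
          have := hM x
          have := hL x
          gcongr
      _ = _ := by ring
  have hm : ∀ c, Measurable (fun x => Q x + c * D x) := fun c => by fun_prop
  refine (hasDerivAt_integral_of_dominated_loc_of_deriv_le (μ := μ)
    (F := fun u x => f x * ew r b (fun x => Q x + u * D x) x)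
    (F' := fun u x => ((b / 2) * (f x * D x)) * ew r b (fun x => Q x + u * D x) x)
    (bound := fun x => |(b / 2) * (f x * D x)| * Real.exp ((M + (|u| + 1) * L) ^ 2 / 4))
    (Metric.ball_mem_nhds u one_pos) ?_ ?_ ?_ ?_ ?_ ?_).2
  · exact Eventually.of_forall fun c => hf.1.mul (ew_meas hr (hm c) b).aestronglyMeasurable
  · exact int_N hr (hm u) (fun x => hb u x (by linarith)) hf
  · exact ((hfD.const_mul (b / 2)).1).mul (ew_meas hr (hm u) b).aestronglyMeasurable
  · refine Eventually.of_forall fun x c hc => ?_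
    rw [norm_mul, Real.norm_of_nonneg (ew_pos _ _ x).le]
    have hc' : |c| ≤ |u| + 1 := by
      rw [Metric.mem_ball, Real.dist_eq] at hc
      have := abs_sub_abs_le_abs_sub c u
      linarith
    exact mul_le_mul_of_nonneg_left (ew_le (Q := fun x => Q x + c * D x) (hb c x hc'))
      (norm_nonneg _)
  · exact (hfD.const_mul (b / 2)).norm.mul_const _
  · refine Eventually.of_forall fun x c _ => ?_
    unfold ew
    have h1 := ((((hasDerivAt_id c).mul_const (D x)).const_add (Q x)).const_mul b).div_const 2
    have h2 := ((h1.const_add (-(b ^ 2 * r x ^ 2) / 4)).exp).const_mul (f x)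
    refine h2.congr_deriv ?_
    simp
    ring

theorem NN_const_mul (b c : ℝ) (Q f : X → ℝ) :
    NN μ r b Q (fun x => c * f x) = c * NN μ r b Q f := by
  simp only [NN, ← integral_const_mul, mul_assoc]

theorem GG_const_mul (b c : ℝ) (Q f : X → ℝ) :
    GG μ r b Q (fun x => c * f x) = c * GG μ r b Q f := by
  simp only [GG, NN_const_mul, mul_div_assoc]

theorem GG_add (hr : Measurable r) {Q : X → ℝ} (hQ : Measurable Q) {b M : ℝ}
    (hM : ∀ x, |Q x| ≤ M * r x) {f g : X → ℝ} (hf : Integrable f μ) (hg : Integrable g μ) :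
    GG μ r b Q (fun x => f x + g x) = GG μ r b Q f + GG μ r b Q g := by
  simp only [GG, NN, add_mul]
  rw [integral_add (int_N hr hQ hM hf) (int_N hr hQ hM hg), add_div]

theorem GG_sum (hr : Measurable r) {Q : X → ℝ} (hQ : Measurable Q) {b M : ℝ}
    (hM : ∀ x, |Q x| ≤ M * r x) {ι : Type*} (s : Finset ι) {f : ι → X → ℝ}
    (hf : ∀ i, Integrable (f i) μ) :
    GG μ r b Q (fun x => ∑ i ∈ s, f i x) = ∑ i ∈ s, GG μ r b Q (f i) := by
  simp only [GG, NN, Finset.sum_mul]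
  rw [integral_finsetSum _ (fun i _ => int_N hr hQ hM (hf i)), Finset.sum_div]

theorem GG_abs_le (hr : Measurable r) {Q : X → ℝ} (hQ : Measurable Q) {b M : ℝ}
    (hM : ∀ x, |Q x| ≤ M * r x) {f h : X → ℝ} (hh : Integrable h μ) (hfh : ∀ x, |f x| ≤ h x) :
    |GG μ r b Q f| ≤ GG μ r b Q h := by
  have hZ : 0 < ZZ μ r b Q := ZZ_pos hr hQ hM
  unfold GG
  rw [abs_div, abs_of_pos hZ]
  gcongr
  unfold NN
  rw [← Real.norm_eq_abs]
  refine norm_integral_le_of_norm_le (int_N hr hQ hM hh) (Eventually.of_forall fun x => ?_)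
  rw [norm_mul, Real.norm_of_nonneg (ew_pos _ _ x).le]
  exact mul_le_mul_of_nonneg_right (hfh x) (ew_pos _ _ x).le

theorem GG_one (hr : Measurable r) {Q : X → ℝ} (hQ : Measurable Q) {b M : ℝ}
    (hM : ∀ x, |Q x| ≤ M * r x) : GG μ r b Q (fun _ => 1) = 1 := by
  unfold GG
  rw [NN_one, div_self (ZZ_pos hr hQ hM).ne']

theorem deriv_GG (hr : Measurable r) (hr0 : ∀ x, 0 ≤ r x) {Q D f : X → ℝ}
    (hQ : Measurable Q) (hD : Measurable D) {b M L : ℝ} (hM : ∀ x, |Q x| ≤ M * r x)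
    (hL : ∀ x, |D x| ≤ L * r x) (hM0 : 0 ≤ M) (hL0 : 0 ≤ L) (hf : Integrable f μ)
    (hDi : Integrable D μ)
    (hfD : Integrable (fun x => f x * D x) μ) (u : ℝ) :
    HasDerivAt (fun u => GG μ r b (fun x => Q x + u * D x) f)
      ((b / 2) * (GG μ r b (fun x => Q x + u * D x) (fun x => f x * D x)
        - GG μ r b (fun x => Q x + u * D x) f * GG μ r b (fun x => Q x + u * D x) D)) u := by
  have hb : ∀ x, |Q x + u * D x| ≤ (M + |u| * L) * r x := by
    intro x
    calc |Q x + u * D x| ≤ |Q x| + |u| * |D x| := by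
          rw [← abs_mul]; exact abs_add_le _ _
      _ ≤ M * r x + |u| * (L * r x) := by
          have := hM x
          have := hL x
          gcongr
      _ = _ := by ring
  have hZ : 0 < ZZ μ r b (fun x => Q x + u * D x) := ZZ_pos hr (by fun_prop) hb
  have h1 := deriv_u (b := b) hr hr0 hQ hD hM hL hL0 hf hfD u
  have h2 := deriv_u (b := b) hr hr0 hQ hD hM hL hL0 (f := fun _ => 1) (integrable_const _)
    (by simpa using hDi) u
  simp only [NN_one, one_mul] at h2
  refine (h1.div h2 hZ.ne').congr_deriv ?_
  simp only [GG, NN_const_mul]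
  field_simp

theorem log_ZZ_le (hr : Measurable r) {Q : X → ℝ} (hQ : Measurable Q) {b M : ℝ}
    (hM : ∀ x, |Q x| ≤ M * r x) : Real.log (ZZ μ r b Q) ≤ M ^ 2 / 4 := by
  rw [Real.log_le_iff_le_exp (ZZ_pos hr hQ hM)]
  calc ZZ μ r b Q ≤ ∫ _, Real.exp (M ^ 2 / 4) ∂μ :=
        integral_mono (int_Z hr hQ hM) (integrable_const _) (fun x => ew_le (hM x))
    _ = _ := by simp

theorem le_log_ZZ (hr : Measurable r) (hmr : Mom μ r) {Q : X → ℝ} (hQ : Measurable Q) {b M : ℝ}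
    (hb : 0 ≤ b) (hM : ∀ x, |Q x| ≤ M * r x) :
    -(b ^ 2 / 4 * ∫ x, r x ^ 2 ∂μ + b / 2 * (M * ∫ x, r x ∂μ)) ≤ Real.log (ZZ μ r b Q) := by
  rw [Real.le_log_iff_exp_le (ZZ_pos hr hQ hM)]
  have hi1 := hmr.integrable
  have hi2 := (hmr.pow 2).integrable
  set c := -(b ^ 2 / 4 * ∫ x, r x ^ 2 ∂μ + b / 2 * (M * ∫ x, r x ∂μ)) with hc
  have hintg : Integrable (fun x => Real.exp c *
      (1 + (-(b ^ 2 / 4 * r x ^ 2 + b / 2 * (M * r x)) - c))) μ := by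
    refine Integrable.const_mul ?_ _
    refine (integrable_const _).add (Integrable.sub ?_ (integrable_const _))
    exact ((hi2.const_mul _).add ((hi1.const_mul _).const_mul _)).neg
  calc Real.exp c = ∫ x, Real.exp c *
      (1 + (-(b ^ 2 / 4 * r x ^ 2 + b / 2 * (M * r x)) - c)) ∂μ := by
        rw [integral_const_mul, integral_add (integrable_const _), integral_sub, integral_neg,
          integral_add, integral_const_mul, integral_const_mul, integral_const_mul]
        · simp [← hc]
        · exact hi2.const_mul _
        · exact (hi1.const_mul _).const_mul _
        · exact ((hi2.const_mul _).add ((hi1.const_mul _).const_mul _)).neg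
        · exact integrable_const _
        · exact (((hi2.const_mul _).add ((hi1.const_mul _).const_mul _)).neg).sub
            (integrable_const _)
    _ ≤ ZZ μ r b Q := by
        refine integral_mono hintg (int_Z hr hQ hM) (fun x => ?_)
        have h1 : -(b ^ 2 / 4 * r x ^ 2 + b / 2 * (M * r x)) ≤
            -(b ^ 2 * r x ^ 2) / 4 + b * Q x / 2 := by
          have := neg_le_of_abs_le (hM x)
          nlinarith
        have h2 := Real.add_one_le_exp (-(b ^ 2 / 4 * r x ^ 2 + b / 2 * (M * r x)) - c)
        calc Real.exp c * (1 + (-(b ^ 2 / 4 * r x ^ 2 + b / 2 * (M * r x)) - c))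
            ≤ Real.exp c * Real.exp (-(b ^ 2 / 4 * r x ^ 2 + b / 2 * (M * r x)) - c) := by
              gcongr; linarith
          _ = Real.exp (-(b ^ 2 / 4 * r x ^ 2 + b / 2 * (M * r x))) := by
              rw [← Real.exp_add]; ring_nf
          _ ≤ _ := Real.exp_le_exp.2 h1

theorem GG_r2_le' (hr : Measurable r) (hmr : Mom μ r) {Q : X → ℝ}
    (hQ : Measurable Q) {b M : ℝ} (hb : 0 < b) (hM : ∀ x, |Q x| ≤ M * r x) :
    b ^ 2 / 8 * GG μ r b Q (fun x => r x ^ 2) ≤ M ^ 2 / 2 - Real.log (ZZ μ r b Q) := by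
  have hZ : 0 < ZZ μ r b Q := ZZ_pos hr hQ hM
  have hi2 := (hmr.pow 2).integrable
  set K := M ^ 2 / 2 - Real.log (ZZ μ r b Q) with hK
  have h1 : ∫ x, (1 + (b ^ 2 / 8 * r x ^ 2 - K)) * ew r b Q x ∂μ ≤ ∫ _, ZZ μ r b Q ∂μ := by
    refine integral_mono (int_N hr hQ hM ?_) (integrable_const _) (fun x => ?_)
    · exact (integrable_const _).add ((hi2.const_mul _).sub (integrable_const _))
    · have h2 := Real.add_one_le_exp (b ^ 2 / 8 * r x ^ 2 - K)
      calc (1 + (b ^ 2 / 8 * r x ^ 2 - K)) * ew r b Q x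
          ≤ Real.exp (b ^ 2 / 8 * r x ^ 2 - K) * ew r b Q x := by
            have := ew_pos (r := r) b Q x
            gcongr; linarith
        _ = Real.exp (b ^ 2 / 8 * r x ^ 2 - K + (-(b ^ 2 * r x ^ 2) / 4 + b * Q x / 2)) := by
            rw [ew, ← Real.exp_add]
        _ ≤ Real.exp (Real.log (ZZ μ r b Q)) := by
            apply Real.exp_le_exp.2
            have h3 := le_of_abs_le (hM x)
            have h4 : b * Q x ≤ b * (M * r x) := mul_le_mul_of_nonneg_left h3 hb.le
            nlinarith [sq_nonneg (b * r x - 2 * M)]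
        _ = ZZ μ r b Q := Real.exp_log hZ
  have h5 : ∫ x, (1 + (b ^ 2 / 8 * r x ^ 2 - K)) * ew r b Q x ∂μ
      = (1 - K) * ZZ μ r b Q + b ^ 2 / 8 * NN μ r b Q (fun x => r x ^ 2) := by
    unfold ZZ NN
    rw [← integral_const_mul, ← integral_const_mul, ← integral_add]
    · congr 1; ext x; ring
    · exact (int_Z hr hQ hM).const_mul _
    · exact (int_N hr hQ hM hi2).const_mul _
  rw [h5] at h1
  simp only [integral_const, probReal_univ, one_smul] at h1
  unfold GG
  rw [← mul_div_assoc, div_le_iff₀ hZ]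
  linarith

/-- polynomial bound for the second moment -/
def Bd (μ : Measure X) (r : X → ℝ) (b1 b2 M : ℝ) : ℝ :=
  8 / b1 ^ 2 * (M ^ 2 / 2 + (b2 ^ 2 / 4 * ∫ x, r x ^ 2 ∂μ + b2 / 2 * (M * ∫ x, r x ∂μ)))

theorem GG_r2_le (hr : Measurable r) (hr0 : ∀ x, 0 ≤ r x) (hmr : Mom μ r) {Q : X → ℝ}
    (hQ : Measurable Q) {b b1 b2 M : ℝ} (hb1 : 0 < b1) (h1 : b1 ≤ b) (h2 : b ≤ b2)
    (hM0 : 0 ≤ M) (hM : ∀ x, |Q x| ≤ M * r x) :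
    GG μ r b Q (fun x => r x ^ 2) ≤ Bd μ r b1 b2 M := by
  have hb : 0 < b := hb1.trans_le h1
  have a1 := GG_r2_le' hr hmr hQ hb hM
  have a2 := le_log_ZZ hr hmr hQ hb.le hM
  have i1 : 0 ≤ ∫ x, r x ∂μ := integral_nonneg hr0
  have i2 : 0 ≤ ∫ x, r x ^ 2 ∂μ := integral_nonneg fun x => sq_nonneg _
  have a3 : b ^ 2 / 8 * GG μ r b Q (fun x => r x ^ 2) ≤
    (M ^ 2 / 2 + (b ^ 2 / 4 * ∫ x, r x ^ 2 ∂μ + b / 2 * (M * ∫ x, r x ∂μ))) := by linarith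
  have a4 : GG μ r b Q (fun x => r x ^ 2) ≤ 8 / b ^ 2 *
    (M ^ 2 / 2 + (b ^ 2 / 4 * ∫ x, r x ^ 2 ∂μ + b / 2 * (M * ∫ x, r x ∂μ))) := by
    calc GG μ r b Q (fun x => r x ^ 2)
        = 8 / b ^ 2 * (b ^ 2 / 8 * GG μ r b Q (fun x => r x ^ 2)) := by field_simp
      _ ≤ _ := by gcongr
  refine a4.trans ?_
  unfold Bd
  gcongr

theorem Bd_nonneg (hr0 : ∀ x, 0 ≤ r x) {b1 b2 M : ℝ} (hb2 : 0 ≤ b2)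
    (hM0 : 0 ≤ M) : 0 ≤ Bd μ r b1 b2 M := by
  have i1 : 0 ≤ ∫ x, r x ∂μ := integral_nonneg hr0
  have i2 : 0 ≤ ∫ x, r x ^ 2 ∂μ := integral_nonneg fun x => sq_nonneg _
  unfold Bd
  positivity

theorem GG_le_Bd (hr : Measurable r) (hr0 : ∀ x, 0 ≤ r x) (hmr : Mom μ r) {Q : X → ℝ}
    (hQ : Measurable Q) {b b1 b2 M : ℝ} (hb1 : 0 < b1) (h1 : b1 ≤ b) (h2 : b ≤ b2)
    (hM0 : 0 ≤ M) (hM : ∀ x, |Q x| ≤ M * r x) {f : X → ℝ} {c d : ℝ} (hd : 0 ≤ d)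
    (hf : ∀ x, |f x| ≤ c + d * r x ^ 2) :
    |GG μ r b Q f| ≤ c + d * Bd μ r b1 b2 M := by
  have hi2 := (hmr.pow 2).integrable
  refine (GG_abs_le hr hQ hM (h := fun x => c * 1 + d * r x ^ 2)
    ((integrable_const _).add (hi2.const_mul _)) (fun x => by simpa using hf x)).trans ?_
  rw [GG_add hr hQ hM (integrable_const _) (hi2.const_mul _), GG_const_mul (f := fun _ => 1),
    GG_const_mul, GG_one hr hQ hM, mul_one]
  have := GG_r2_le hr hr0 hmr hQ hb1 h1 h2 hM0 hM
  gcongr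

end gibbsAbs


section concrete
variable {n : ℕ}

def rr (x : Fin n → ℝ) : ℝ := ∑ i, x i ^ 2

def QY (Y : Matrix (Fin n) (Fin n) ℝ) (x : Fin n → ℝ) : ℝ := ∑ i, ∑ j, Y i j * (x i * x j)

def MY (Y : Matrix (Fin n) (Fin n) ℝ) : ℝ := ∑ i, ∑ j, |Y i j|

theorem rr_nonneg (x : Fin n → ℝ) : 0 ≤ rr x := Finset.sum_nonneg fun _ _ => sq_nonneg _

theorem MY_nonneg (Y : Matrix (Fin n) (Fin n) ℝ) : 0 ≤ MY Y :=
  Finset.sum_nonneg fun _ _ => Finset.sum_nonneg fun _ _ => abs_nonneg _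

theorem rr_meas : Measurable (rr : (Fin n → ℝ) → ℝ) := by
  unfold rr; fun_prop

theorem QY_meas (Y : Matrix (Fin n) (Fin n) ℝ) : Measurable (QY Y) := by
  unfold QY; fun_prop

theorem xx_le (x : Fin n → ℝ) (i j : Fin n) : |x i * x j| ≤ rr x := by
  have h : ∀ i, x i ^ 2 ≤ rr x := fun i =>
    Finset.single_le_sum (f := fun i => x i ^ 2) (fun _ _ => sq_nonneg _) (Finset.mem_univ i)
  have hi := h i
  have hj := h j
  rw [abs_le]
  constructor <;> nlinarith [sq_nonneg (x i - x j), sq_nonneg (x i + x j)]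

theorem QY_le (Y : Matrix (Fin n) (Fin n) ℝ) (x : Fin n → ℝ) : |QY Y x| ≤ MY Y * rr x := by
  unfold QY MY
  simp only [Finset.sum_mul]
  refine (Finset.abs_sum_le_sum_abs _ _).trans (Finset.sum_le_sum fun i _ => ?_)
  refine (Finset.abs_sum_le_sum_abs _ _).trans (Finset.sum_le_sum fun j _ => ?_)
  rw [abs_mul]
  exact mul_le_mul_of_nonneg_left (xx_le x i j) (abs_nonneg _)

theorem rr_sq (x : Fin n → ℝ) : rr x ^ 2 = ∑ i, ∑ j, (x i * x j) * (x i * x j) := by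
  unfold rr
  rw [sq, Finset.sum_mul_sum]
  refine Finset.sum_congr rfl fun i _ => Finset.sum_congr rfl fun j _ => ?_
  ring

instance (v : ℝ) : IsProbabilityMeasure (gaussPrior n v) := by
  unfold gaussPrior; infer_instance

theorem mom_prior (v : ℝ) (i : Fin n) : Mom (gaussPrior n v) (fun x => x i) :=
  mom_pi (fun _ : Fin n => Real.toNNReal v) i

theorem mom_rr (v : ℝ) : Mom (gaussPrior n v) rr :=
  Mom.sum _ fun i => (mom_prior v i).pow 2

theorem trace_eq (Y : Matrix (Fin n) (Fin n) ℝ) (x : Fin n → ℝ) :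
    Matrix.trace (Y * Matrix.vecMulVec x x) = QY Y x := by
  simp only [Matrix.trace, Matrix.diag, Matrix.mul_apply, Matrix.vecMulVec_apply, QY]
  refine Finset.sum_congr rfl fun i _ => Finset.sum_congr rfl fun j _ => ?_
  ring

theorem partitionFn_eq (sig' : ℝ) {t : ℝ} (ht : 0 ≤ t) (Y : Matrix (Fin n) (Fin n) ℝ) :
    partitionFn n sig' t Y = ZZ (gaussPrior n (sig' ^ 2)) rr (Real.sqrt (t / n)) (QY Y) := by
  unfold partitionFn ZZ ew
  have h : Real.sqrt (t / n) ^ 2 = t / n := Real.sq_sqrt (by positivity)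
  congr 1; ext x
  rw [trace_eq, h]
  congr 1
  simp only [rr]
  ring

theorem weight_eq {t : ℝ} (ht : 0 ≤ t) (Y : Matrix (Fin n) (Fin n) ℝ) (x : Fin n → ℝ) :
    weight n t Y x = Real.exp (-(1 / 4) * frobSq Y) * ew rr (Real.sqrt (t / n)) (QY Y) x := by
  unfold weight ew
  rw [← Real.exp_add]
  congr 1
  rw [rr_sq]
  simp only [frobSq, QY, Finset.mul_sum, Finset.sum_div, ← Finset.sum_add_distrib,
    ← Finset.sum_neg_distrib]
  refine Finset.sum_congr rfl fun i _ => Finset.sum_congr rfl fun j _ => ?_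
  simp only [Matrix.sub_apply, Matrix.smul_apply, Matrix.vecMulVec_apply, smul_eq_mul]
  ring

theorem gibbs_eq (sig' : ℝ) {t : ℝ} (ht : 0 ≤ t) (Y : Matrix (Fin n) (Fin n) ℝ)
    (f : (Fin n → ℝ) → ℝ) :
    gibbs n sig' t Y f = GG (gaussPrior n (sig' ^ 2)) rr (Real.sqrt (t / n)) (QY Y) f := by
  unfold gibbs GG NN ZZ
  simp only [weight_eq ht, mul_left_comm (f _)]
  rw [integral_const_mul, integral_const_mul, mul_div_mul_left _ _ (Real.exp_pos _).ne']

section meas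
variable {Ω : Type*} [MeasurableSpace Ω] (μ : Measure (Fin n → ℝ)) [IsProbabilityMeasure μ]
  {Y : Ω → Matrix (Fin n) (Fin n) ℝ}

theorem meas_NN (hY : ∀ i j, Measurable fun ω => Y ω i j) (b : ℝ) {f : Ω → (Fin n → ℝ) → ℝ}
    (hf : Measurable (Function.uncurry f)) :
    Measurable (fun ω => NN μ rr b (QY (Y ω)) (f ω)) := by
  have hm : Measurable (fun z : Ω × (Fin n → ℝ) => f z.1 z.2 * ew rr b (QY (Y z.1)) z.2) := by
    have h1 : Measurable (fun z : Ω × (Fin n → ℝ) => f z.1 z.2) := hf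
    have h2 : Measurable (fun z : Ω × (Fin n → ℝ) => QY (Y z.1) z.2) := by
      unfold QY
      refine Finset.measurable_sum _ fun i _ => Finset.measurable_sum _ fun j _ => ?_
      have := (hY i j).comp (measurable_fst : Measurable (Prod.fst : Ω × (Fin n → ℝ) → Ω))
      simp only [Function.comp_def] at this
      fun_prop
    have h3 : Measurable (fun z : Ω × (Fin n → ℝ) => rr z.2) := rr_meas.comp measurable_snd
    unfold ew
    fun_prop
  exact (hm.stronglyMeasurable.integral_prod_right' (ν := μ)).measurable

theorem meas_ZZ (hY : ∀ i j, Measurable fun ω => Y ω i j) (b : ℝ) :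
    Measurable (fun ω => ZZ μ rr b (QY (Y ω))) := by
  simp only [← NN_one]
  exact meas_NN μ hY b (f := fun _ _ => 1) measurable_const

theorem meas_GG (hY : ∀ i j, Measurable fun ω => Y ω i j) (b : ℝ) {f : Ω → (Fin n → ℝ) → ℝ}
    (hf : Measurable (Function.uncurry f)) :
    Measurable (fun ω => GG μ rr b (QY (Y ω)) (f ω)) :=
  (meas_NN μ hY b hf).div (meas_ZZ μ hY b)

end meas

/-- symmetrization weights -/
def ww (i j : Fin n) : ℝ := if i = j then 1 else if i < j then 2 else 0

theorem sumsym (A : Fin n → Fin n → ℝ) :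
    ∑ i, ∑ j, (if i ≤ j then A i j else A j i) = ∑ i, ∑ j, ww i j * A i j := by
  have h : ∀ i j, (if i ≤ j then A i j else A j i)
      = (if i ≤ j then A i j else 0) + (if j < i then A j i else 0) := by
    intro i j
    by_cases hij : i ≤ j
    · simp [hij, not_lt.2 hij]
    · simp [hij, not_le.1 hij]
  simp only [h, Finset.sum_add_distrib]
  rw [Finset.sum_comm (f := fun i j => if j < i then A j i else 0)]
  simp only [← Finset.sum_add_distrib]
  refine Finset.sum_congr rfl fun i _ => Finset.sum_congr rfl fun j _ => ?_
  unfold ww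
  rcases lt_trichotomy i j with h | h | h
  · simp [h, h.le, h.ne]; ring
  · simp [h]
  · simp [h.not_ge, h.ne', h.not_gt]

theorem sumsym' (A : Fin n → Fin n → ℝ) (hA : ∀ i j, A i j = A j i) :
    ∑ i, ∑ j, A i j = ∑ i, ∑ j, ww i j * A i j := by
  rw [← sumsym]
  refine Finset.sum_congr rfl fun i _ => Finset.sum_congr rfl fun j _ => ?_
  rw [hA j i, ite_self]

/-- variances -/
def vv (p : Fin n × Fin n) : NNReal := if p.1 = p.2 then 2 else 1

theorem vv_ne (p : Fin n × Fin n) : vv p ≠ 0 := by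
  unfold vv; split_ifs <;> norm_num

theorem vw (i j : Fin n) : (vv (i, j) : ℝ) * ww i j ^ 2 = 2 * ww i j := by
  unfold vv ww
  by_cases h : i = j
  · simp [h]
  · by_cases h' : i < j
    · simp [h, h']; norm_num
    · simp [h, h']

def symmG (g : Fin n × Fin n → ℝ) : Matrix (Fin n) (Fin n) ℝ :=
  Matrix.of fun i j => if i ≤ j then g (i, j) else g (j, i)

def gpi (n : ℕ) : Measure (Fin n × Fin n → ℝ) := Measure.pi fun p => gaussianReal 0 (vv p)

instance : IsProbabilityMeasure (gpi n) := by unfold gpi; infer_instance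

theorem symmG_entry_meas (i j : Fin n) : Measurable fun g => symmG g i j := by
  by_cases h : i ≤ j <;> simp [symmG, h] <;> fun_prop

theorem symmG_meas : Measurable (symmG : (Fin n × Fin n → ℝ) → Matrix (Fin n) (Fin n) ℝ) := by
  have : Measurable (fun g : Fin n × Fin n → ℝ => (fun i j => symmG g i j : Fin n → Fin n → ℝ)) :=
    measurable_pi_iff.2 fun i => measurable_pi_iff.2 fun j => symmG_entry_meas i j
  exact this

theorem entry_meas (i j : Fin n) : Measurable fun Z : Matrix (Fin n) (Fin n) ℝ => Z i j := by
  have : Measurable (fun Z : Fin n → Fin n → ℝ => Z i j) := by fun_prop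
  exact this

theorem noise_mp : MeasurePreserving (symmG : (Fin n × Fin n → ℝ) → _) (gpi n) (noiseMeasure n) :=
  ⟨symmG_meas, rfl⟩

instance : IsProbabilityMeasure (noiseMeasure n) := by
  rw [← noise_mp.map_eq]
  exact Measure.isProbabilityMeasure_map symmG_meas.aemeasurable

/-- the base probability space -/
def PP (n : ℕ) (v : ℝ) : Measure ((Fin n → ℝ) × (Fin n × Fin n → ℝ)) :=
  (gaussPrior n v).prod (gpi n)

instance (v : ℝ) : IsProbabilityMeasure (PP n v) := by unfold PP; infer_instance

theorem transfer (v : ℝ) (F : (Fin n → ℝ) × Matrix (Fin n) (Fin n) ℝ → ℝ) (hF : Measurable F) :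
    ∫ p, F p ∂((gaussPrior n v).prod (noiseMeasure n)) = ∫ ω, F (ω.1, symmG ω.2) ∂(PP n v) := by
  have hmp := (MeasurePreserving.id (gaussPrior n v)).prod (noise_mp (n := n))
  rw [← hmp.map_eq, integral_map hmp.measurable.aemeasurable hF.aestronglyMeasurable]
  rfl

def Yf (lam : ℝ) (ω : (Fin n → ℝ) × (Fin n × Fin n → ℝ)) : Matrix (Fin n) (Fin n) ℝ :=
  obs n lam ω.1 (symmG ω.2)

theorem Yf_apply (lam : ℝ) (ω : (Fin n → ℝ) × (Fin n × Fin n → ℝ)) (i j : Fin n) :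
    Yf lam ω i j = Real.sqrt (lam / n) * (ω.1 i * ω.1 j) + symmG ω.2 i j := by
  simp [Yf, obs, Matrix.vecMulVec_apply]

theorem Yf_meas (lam : ℝ) (i j : Fin n) : Measurable fun ω => Yf lam ω i j := by
  simp only [Yf_apply]
  have := (symmG_entry_meas i j).comp
    (measurable_snd : Measurable (Prod.snd : (Fin n → ℝ) × (Fin n × Fin n → ℝ) → _))
  simp only [Function.comp_def] at this
  fun_prop

theorem mom_s (v : ℝ) (i : Fin n) : Mom (PP n v) (fun ω => ω.1 i) :=
  (mom_prior v i).comp measurePreserving_fst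

theorem mom_g (v : ℝ) (p : Fin n × Fin n) : Mom (PP n v) (fun ω => ω.2 p) :=
  (mom_pi vv p).comp (measurePreserving_snd (μ := gaussPrior n v) (ν := gpi n))

theorem mom_MY (v lam : ℝ) : Mom (PP n v) (fun ω => MY (Yf lam ω)) := by
  unfold MY
  refine Mom.sum _ fun i => Mom.sum _ fun j => Mom.abs ?_
  simp only [Yf_apply]
  refine ((Mom.const _).mul ((mom_s v i).mul (mom_s v j))).add ?_
  by_cases h : i ≤ j
  · simp only [symmG, h, Matrix.of_apply, if_true]; exact mom_g v _
  · simp only [symmG, h, Matrix.of_apply, if_false]; exact mom_g v _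

theorem mom_Bd (v lam : ℝ) (μ : Measure (Fin n → ℝ)) (b1 b2 : ℝ) :
    Mom (PP n v) (fun ω => Bd μ rr b1 b2 (MY (Yf lam ω))) := by
  unfold Bd
  have h := mom_MY (n := n) v lam
  refine (Mom.const _).mul (Mom.add ?_ (Mom.add (Mom.const _)
    ((Mom.const _).mul (h.mul (Mom.const _)))))
  simp only [div_eq_mul_inv]
  exact (h.pow 2).mul (Mom.const _)

theorem mom_GG (v lam v' : ℝ) {b : ℝ} (hb : 0 < b) {f : (Fin n → ℝ) → ℝ} (hf : Measurable f)
    {c d : ℝ} (hd : 0 ≤ d) (hfb : ∀ x, |f x| ≤ c + d * rr x ^ 2) :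
    Mom (PP n v) (fun ω => GG (gaussPrior n v') rr b (QY (Yf lam ω)) f) := by
  have hm := (meas_GG (gaussPrior n v') (Yf_meas (n := n) lam) b (f := fun _ => f)
    (hf.comp measurable_snd)).aestronglyMeasurable (μ := PP n v)
  refine ((Mom.const c).add ((Mom.const d).mul
    (mom_Bd (n := n) v lam (gaussPrior n v') b b))).mono hm fun ω => ?_
  refine le_trans ?_ (le_abs_self _)
  exact GG_le_Bd rr_meas rr_nonneg (mom_rr v') (QY_meas _) hb le_rfl le_rfl (MY_nonneg _)
    (QY_le _) hd hfb

theorem deriv_logZ (v lam v' : ℝ) {b : ℝ} (hb : 0 < b) :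
    HasDerivAt (fun b => ∫ ω, Real.log (ZZ (gaussPrior n v') rr b (QY (Yf lam ω))) ∂(PP n v))
      (∫ ω, GG (gaussPrior n v') rr b (QY (Yf lam ω))
        (fun x => -(b / 2) * rr x ^ 2 + QY (Yf lam ω) x / 2) ∂(PP n v)) b := by
  set μ := gaussPrior n v' with hμ
  have hM := mom_MY (n := n) v lam
  refine (hasDerivAt_integral_of_dominated_loc_of_deriv_le (μ := PP n v)
    (F := fun b ω => Real.log (ZZ μ rr b (QY (Yf lam ω))))
    (F' := fun b ω => GG μ rr b (QY (Yf lam ω))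
        (fun x => -(b / 2) * rr x ^ 2 + QY (Yf lam ω) x / 2))
    (bound := fun ω => MY (Yf lam ω) * (1 / 2) + (b + MY (Yf lam ω) * (1 / 2)) *
      Bd μ rr (b / 2) (2 * b) (MY (Yf lam ω)))
    (s := Set.Icc (b / 2) (2 * b))
    (Icc_mem_nhds (by linarith) (by linarith)) ?_ ?_ ?_ ?_ ?_ ?_).2
  · exact Eventually.of_forall fun c =>
      (meas_ZZ μ (Yf_meas lam) c).log.aestronglyMeasurable
  · refine (((hM.pow 2).mul (Mom.const (1 / 4))).add ((Mom.const (b ^ 2 / 4 * ∫ x, rr x ^ 2 ∂μ)).add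
      ((Mom.const (b / 2)).mul (hM.mul (Mom.const (∫ x, rr x ∂μ)))))).integrable.mono'
      (meas_ZZ μ (Yf_meas lam) b).log.aestronglyMeasurable (Eventually.of_forall fun ω => ?_)
    have h1 := log_ZZ_le (μ := μ) (b := b) rr_meas (QY_meas (Yf lam ω)) (QY_le _)
    have h2 := le_log_ZZ (μ := μ) (b := b) rr_meas (mom_rr v') (QY_meas (Yf lam ω)) hb.le (QY_le _)
    have i1 : 0 ≤ ∫ x, rr x ∂μ := integral_nonneg rr_nonneg
    have i2 : 0 ≤ ∫ x, rr x ^ 2 ∂μ := integral_nonneg fun x => sq_nonneg _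
    have i3 := MY_nonneg (Yf lam ω)
    have i4 : 0 ≤ b ^ 2 / 4 * ∫ x, rr x ^ 2 ∂μ := by positivity
    have i5 : 0 ≤ b / 2 * (MY (Yf lam ω) * ∫ x, rr x ∂μ) := by positivity
    have i6 : 0 ≤ MY (Yf lam ω) ^ 2 := by positivity
    rw [Real.norm_eq_abs, abs_le]
    constructor <;> linarith
  · refine (meas_GG μ (Yf_meas lam) b ?_).aestronglyMeasurable
    have h2 : Measurable (fun z : ((Fin n → ℝ) × (Fin n × Fin n → ℝ)) × (Fin n → ℝ) =>
        QY (Yf lam z.1) z.2) := by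
      unfold QY
      refine Finset.measurable_sum _ fun i _ => Finset.measurable_sum _ fun j _ => ?_
      have := (Yf_meas lam i j).comp (measurable_fst :
        Measurable (Prod.fst : ((Fin n → ℝ) × (Fin n × Fin n → ℝ)) × (Fin n → ℝ) → _))
      simp only [Function.comp_def] at this
      fun_prop
    have h3 : Measurable (fun z : ((Fin n → ℝ) × (Fin n × Fin n → ℝ)) × (Fin n → ℝ) => rr z.2) :=
      rr_meas.comp measurable_snd
    simp only [Function.uncurry_def]
    fun_prop
  · refine Eventually.of_forall fun ω c hc => ?_
    have i3 := MY_nonneg (Yf lam ω)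
    refine GG_le_Bd rr_meas rr_nonneg (mom_rr v') (QY_meas _) (by linarith) hc.1 hc.2 i3
      (QY_le _) (by linarith) (fun x => ?_)
    have h1 := QY_le (Yf lam ω) x
    have hc0 : 0 ≤ c := by linarith [hc.1]
    have h3 : rr x ≤ 1 + rr x ^ 2 := by nlinarith [sq_nonneg (rr x - 1)]
    refine (abs_add_le _ _).trans ?_
    rw [abs_mul, abs_neg, abs_div, abs_div, abs_of_nonneg hc0, abs_two,
      abs_of_nonneg (sq_nonneg (rr x))]
    have h4 : MY (Yf lam ω) * rr x ≤ MY (Yf lam ω) * (1 + rr x ^ 2) :=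
      mul_le_mul_of_nonneg_left h3 i3
    have h5 : c * rr x ^ 2 ≤ 2 * b * rr x ^ 2 := mul_le_mul_of_nonneg_right hc.2 (sq_nonneg _)
    linarith
  · exact ((hM.mul (Mom.const _)).add (((Mom.const b).add (hM.mul (Mom.const _))).mul
      (mom_Bd (n := n) v lam μ (b / 2) (2 * b)))).integrable
  · refine Eventually.of_forall fun ω c _ => ?_
    exact (deriv_b rr_meas (mom_rr v') (QY_meas (Yf lam ω)) (QY_le _)).log
      (ZZ_pos rr_meas (QY_meas (Yf lam ω)) (QY_le _)).ne'

theorem QYf_eq (lam : ℝ) (ω : (Fin n → ℝ) × (Fin n × Fin n → ℝ)) (x : Fin n → ℝ) :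
    QY (Yf lam ω) x = (∑ i, ∑ j, Real.sqrt (lam / n) * (ω.1 i * ω.1 j) * (x i * x j))
      + ∑ i, ∑ j, ww i j * (ω.2 (i, j) * (x i * x j)) := by
  rw [← sumsym (fun i j => ω.2 (i, j) * (x i * x j))]
  simp only [QY, Yf_apply, ← Finset.sum_add_distrib]
  refine Finset.sum_congr rfl fun i _ => Finset.sum_congr rfl fun j _ => ?_
  simp only [symmG, Matrix.of_apply]
  split_ifs <;> ring

theorem QYf_update (lam : ℝ) (ω : (Fin n → ℝ) × (Fin n × Fin n → ℝ)) (k : Fin n × Fin n) (u : ℝ) :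
    QY (Yf lam (ω.1, Function.update ω.2 k u)) = fun x =>
      QY (Yf lam (ω.1, Function.update ω.2 k 0)) x + u * (ww k.1 k.2 * (x k.1 * x k.2)) := by
  ext x
  rw [QYf_eq, QYf_eq, add_assoc]
  congr 1
  rw [← Fintype.sum_prod_type' (f := fun i j => ww i j * (Function.update ω.2 k u (i, j) * (x i * x j))),
    ← Fintype.sum_prod_type' (f := fun i j => ww i j * (Function.update ω.2 k 0 (i, j) * (x i * x j)))]
  have h : ∀ p : Fin n × Fin n, ww p.1 p.2 * (Function.update ω.2 k u (p.1, p.2) * (x p.1 * x p.2))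
      = ww p.1 p.2 * (Function.update ω.2 k 0 (p.1, p.2) * (x p.1 * x p.2))
        + if p = k then u * (ww p.1 p.2 * (x p.1 * x p.2)) else 0 := by
    intro p
    by_cases hp : p = k
    · subst hp; simp; ring
    · simp [hp]
  simp only [h, Finset.sum_add_distrib]
  simp

theorem xx_bound (x : Fin n → ℝ) (i j : Fin n) : |x i * x j| ≤ 1 + 1 * rr x ^ 2 := by
  have := xx_le x i j
  nlinarith [sq_nonneg (rr x - 1)]

theorem xxxx_bound (x : Fin n → ℝ) (i j : Fin n) :
    |(x i * x j) * (x i * x j)| ≤ 0 + 1 * rr x ^ 2 := by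
  have := xx_le x i j
  rw [abs_mul]
  nlinarith [abs_nonneg (x i * x j)]

theorem ww_nonneg (i j : Fin n) : 0 ≤ ww i j := by
  unfold ww; split_ifs <;> norm_num

theorem stein_ij (v lam v' : ℝ) {b : ℝ} (hb : 0 < b) (i j : Fin n) :
    ∫ ω, ω.2 (i, j) * GG (gaussPrior n v') rr b (QY (Yf lam ω)) (fun x => x i * x j) ∂(PP n v)
    = vv (i, j) * ∫ ω, ww i j * (b / 2) *
      (GG (gaussPrior n v') rr b (QY (Yf lam ω)) (fun x => (x i * x j) * (x i * x j))
      - GG (gaussPrior n v') rr b (QY (Yf lam ω)) (fun x => x i * x j) ^ 2) ∂(PP n v) := by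
  have m1 : Mom (PP n v) (fun ω => GG (gaussPrior n v') rr b (QY (Yf lam ω))
      (fun x => x i * x j)) :=
    mom_GG v lam v' hb (by fun_prop) zero_le_one (fun x => xx_bound x i j)
  have m2 : Mom (PP n v) (fun ω => GG (gaussPrior n v') rr b (QY (Yf lam ω))
      (fun x => (x i * x j) * (x i * x j))) :=
    mom_GG v lam v' hb (by fun_prop) zero_le_one (fun x => xxxx_bound x i j)
  have hx : Mom (gaussPrior n v') (fun x => x i * x j) := (mom_prior v' i).mul (mom_prior v' j)
  refine stein_abs (PP n v) (vv (i, j)) (vv_ne _)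
    (fun z => (z.1.1, Function.update z.1.2 (i, j) z.2))
    (mp_update2 (gaussPrior n v) (fun p => gaussianReal 0 (vv p)) (i, j))
    (fun ω => ω.2 (i, j)) _ _ (fun ω u => by simp) ?_ m1.integrable ?_ ?_
  · intro ω u
    have hfun : (fun u => GG (gaussPrior n v') rr b
          (QY (Yf lam (ω.1, Function.update ω.2 (i, j) u))) (fun x => x i * x j))
        = fun u => GG (gaussPrior n v') rr b (fun x =>
          QY (Yf lam (ω.1, Function.update ω.2 (i, j) 0)) x + u * (ww i j * (x i * x j)))
          (fun x => x i * x j) := by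
      funext u; rw [QYf_update lam ω (i, j) u]
    beta_reduce
    rw [hfun, QYf_update lam ω (i, j) u]
    refine (deriv_GG (μ := gaussPrior n v') (b := b) (L := ww i j) rr_meas rr_nonneg
      (D := fun x => ww i j * (x i * x j))
      (f := fun x => x i * x j)
      (QY_meas (Yf lam (ω.1, Function.update ω.2 (i, j) 0)))
      (by fun_prop) (QY_le _) ?_ (MY_nonneg _)
      (ww_nonneg i j) hx.integrable (hx.integrable.const_mul _) ?_ u).congr_deriv ?_
    · intro x
      rw [abs_mul, abs_of_nonneg (ww_nonneg i j)]
      exact mul_le_mul_of_nonneg_left (xx_le x i j) (ww_nonneg i j)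
    · exact (hx.mul ((Mom.const (ww i j)).mul hx)).integrable
    · have e : (fun x : Fin n → ℝ => x i * x j * (ww i j * (x i * x j)))
          = fun x => ww i j * ((x i * x j) * (x i * x j)) := by ext x; ring
      rw [e, GG_const_mul, GG_const_mul]
      ring
  · refine ((Mom.const _).mul ?_).integrable
    simp only [sub_eq_add_neg]
    refine m2.add ?_
    simp only [neg_eq_neg_one_mul (_ ^ 2)]
    exact (Mom.const _).mul (m1.pow 2)
  · exact ((mom_g v (i, j)).mul m1).integrable

end concrete


section final
variable {n : ℕ}

theorem mom_G (v lam v' : ℝ) {b : ℝ} (hb : 0 < b) (i j : Fin n) :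
    Mom (PP n v) (fun ω => GG (gaussPrior n v') rr b (QY (Yf lam ω)) (fun x => x i * x j)) :=
  mom_GG v lam v' hb (by fun_prop) zero_le_one (fun x => xx_bound x i j)

theorem mom_H (v lam v' : ℝ) {b : ℝ} (hb : 0 < b) (i j : Fin n) :
    Mom (PP n v) (fun ω => GG (gaussPrior n v') rr b (QY (Yf lam ω))
      (fun x => (x i * x j) * (x i * x j))) :=
  mom_GG v lam v' hb (by fun_prop) zero_le_one (fun x => xxxx_bound x i j)

theorem mom_xx (v' : ℝ) (i j : Fin n) : Mom (gaussPrior n v') (fun x => x i * x j) :=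
  (mom_prior v' i).mul (mom_prior v' j)

theorem obs_meas (lam : ℝ) (i j : Fin n) :
    Measurable fun p : (Fin n → ℝ) × Matrix (Fin n) (Fin n) ℝ => obs n lam p.1 p.2 i j := by
  simp only [obs, Matrix.add_apply, Matrix.smul_apply, Matrix.vecMulVec_apply, smul_eq_mul]
  have := (entry_meas i j).comp
    (measurable_snd : Measurable (Prod.snd : (Fin n → ℝ) × Matrix (Fin n) (Fin n) ℝ → _))
  simp only [Function.comp_def] at this
  fun_prop

theorem GG_dsum (v' b : ℝ) (Y : Matrix (Fin n) (Fin n) ℝ) {f : Fin n → Fin n → (Fin n → ℝ) → ℝ}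
    (hf : ∀ i j, Integrable (f i j) (gaussPrior n v')) :
    GG (gaussPrior n v') rr b (QY Y) (fun x => ∑ i, ∑ j, f i j x)
      = ∑ i, ∑ j, GG (gaussPrior n v') rr b (QY Y) (f i j) := by
  rw [GG_sum rr_meas (QY_meas Y) (QY_le Y) (f := fun i x => ∑ j, f i j x)]
  · refine Finset.sum_congr rfl fun i _ => ?_
    rw [GG_sum rr_meas (QY_meas Y) (QY_le Y)]
    exact hf i
  · exact fun i => integrable_finsetSum _ fun j _ => hf i j

theorem GG_square (v' b : ℝ) (Y : Matrix (Fin n) (Fin n) ℝ) (s : Fin n → ℝ) :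
    GG (gaussPrior n v') rr b (QY Y) (fun x => (∑ i, s i * x i) ^ 2)
      = ∑ i, ∑ j, (s i * s j) * GG (gaussPrior n v') rr b (QY Y) (fun x => x i * x j) := by
  have e : (fun x : Fin n → ℝ => (∑ i, s i * x i) ^ 2)
      = fun x => ∑ i, ∑ j, (s i * s j) * (x i * x j) := by
    ext x
    rw [sq, Finset.sum_mul_sum]
    refine Finset.sum_congr rfl fun i _ => Finset.sum_congr rfl fun j _ => ?_
    ring
  rw [e, GG_dsum v' b Y (fun i j => ((mom_xx v' i j).integrable.const_mul _))]
  simp only [GG_const_mul]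

theorem GG_drift (v' b lam : ℝ) (ω : (Fin n → ℝ) × (Fin n × Fin n → ℝ)) :
    GG (gaussPrior n v') rr b (QY (Yf lam ω))
        (fun x => -(b / 2) * rr x ^ 2 + QY (Yf lam ω) x / 2)
    = -(b / 2) * (∑ i, ∑ j, GG (gaussPrior n v') rr b (QY (Yf lam ω))
          (fun x => (x i * x j) * (x i * x j)))
      + (1 / 2) * (Real.sqrt (lam / n) * (∑ i, ∑ j, (ω.1 i * ω.1 j) *
          GG (gaussPrior n v') rr b (QY (Yf lam ω)) (fun x => x i * x j))
        + ∑ i, ∑ j, ww i j * (ω.2 (i, j) *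
          GG (gaussPrior n v') rr b (QY (Yf lam ω)) (fun x => x i * x j))) := by
  have hsym : ∀ i j, GG (gaussPrior n v') rr b (QY (Yf lam ω)) (fun x => x i * x j)
      = GG (gaussPrior n v') rr b (QY (Yf lam ω)) (fun x => x j * x i) := by
    intro i j; simp only [mul_comm]
  have e : (fun x : Fin n → ℝ => -(b / 2) * rr x ^ 2 + QY (Yf lam ω) x / 2)
      = fun x => (-(b / 2)) * (∑ i, ∑ j, (x i * x j) * (x i * x j))
        + (1 / 2) * (∑ i, ∑ j, Yf lam ω i j * (x i * x j)) := by
    ext x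
    rw [rr_sq, QY]
    ring
  have i1 : ∀ i j : Fin n, Integrable (fun x : Fin n → ℝ => (x i * x j) * (x i * x j))
      (gaussPrior n v') := fun i j => ((mom_xx v' i j).mul (mom_xx v' i j)).integrable
  have i2 : ∀ i j : Fin n, Integrable (fun x : Fin n → ℝ => Yf lam ω i j * (x i * x j))
      (gaussPrior n v') := fun i j => (mom_xx v' i j).integrable.const_mul _
  rw [e, GG_add rr_meas (QY_meas _) (QY_le _), GG_const_mul, GG_const_mul, GG_dsum _ _ _ i1,
    GG_dsum _ _ _ i2]
  · congr 2
    simp only [GG_const_mul]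
    rw [← sumsym (fun i j => ω.2 (i, j) *
          GG (gaussPrior n v') rr b (QY (Yf lam ω)) (fun x => x i * x j))]
    simp only [Finset.mul_sum, ← Finset.sum_add_distrib]
    refine Finset.sum_congr rfl fun i _ => Finset.sum_congr rfl fun j _ => ?_
    rw [Yf_apply, hsym j i]
    simp only [symmG, Matrix.of_apply]
    split_ifs <;> ring
  · exact (integrable_finsetSum _ fun i _ => integrable_finsetSum _ fun j _ => i1 i j).const_mul _
  · exact (integrable_finsetSum _ fun i _ => integrable_finsetSum _ fun j _ => i2 i j).const_mul _

theorem integral_dsum {Ω : Type*} [MeasurableSpace Ω] {P : Measure Ω} [IsProbabilityMeasure P]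
    {f : Fin n → Fin n → Ω → ℝ} (hf : ∀ i j, Integrable (f i j) P) :
    ∫ ω, ∑ i, ∑ j, f i j ω ∂P = ∑ i, ∑ j, ∫ ω, f i j ω ∂P := by
  rw [integral_finsetSum _ fun i _ => integrable_finsetSum _ fun j _ => hf i j]
  refine Finset.sum_congr rfl fun i _ => ?_
  rw [integral_finsetSum _ fun j _ => hf i j]

theorem mean_formula (v lam v' : ℝ) {b : ℝ} (hb : 0 < b) :
    ∫ ω, GG (gaussPrior n v') rr b (QY (Yf lam ω))
        (fun x => -(b / 2) * rr x ^ 2 + QY (Yf lam ω) x / 2) ∂(PP n v)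
    = (1 / 2) * Real.sqrt (lam / n) * (∫ ω, ∑ i, ∑ j, (ω.1 i * ω.1 j) *
          GG (gaussPrior n v') rr b (QY (Yf lam ω)) (fun x => x i * x j) ∂(PP n v))
      - (b / 2) * ∫ ω, ∑ i, ∑ j, GG (gaussPrior n v') rr b (QY (Yf lam ω))
          (fun x => x i * x j) ^ 2 ∂(PP n v) := by
  have mG := mom_G (n := n) v lam v' hb
  have mH := mom_H (n := n) v lam v' hb
  have iH := fun i j => (mH i j).integrable
  have iG2 := fun i j => ((mG i j).pow 2).integrable
  have iS := fun i j => (((mom_s v i).mul (mom_s v j)).mul (mG i j)).integrable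
  have igG := fun i j => ((Mom.const (ww i j)).mul ((mom_g v (i, j)).mul (mG i j))).integrable
  simp only [GG_drift]
  rw [integral_add, integral_const_mul, integral_const_mul, integral_add, integral_const_mul,
    integral_dsum igG, integral_dsum iH, integral_dsum iG2]
  · have key : ∑ i, ∑ j, ∫ ω, ww i j * (ω.2 (i, j) *
          GG (gaussPrior n v') rr b (QY (Yf lam ω)) (fun x => x i * x j)) ∂(PP n v)
        = b * (∑ i, ∑ j, ∫ ω, GG (gaussPrior n v') rr b (QY (Yf lam ω))
          (fun x => (x i * x j) * (x i * x j)) ∂(PP n v)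
          - ∑ i, ∑ j, ∫ ω, GG (gaussPrior n v') rr b (QY (Yf lam ω))
          (fun x => x i * x j) ^ 2 ∂(PP n v)) := by
      simp only [← Finset.sum_sub_distrib]
      rw [sumsym' (fun i j => ∫ ω, GG (gaussPrior n v') rr b (QY (Yf lam ω))
          (fun x => (x i * x j) * (x i * x j)) ∂(PP n v)
          - ∫ ω, GG (gaussPrior n v') rr b (QY (Yf lam ω))
          (fun x => x i * x j) ^ 2 ∂(PP n v))]
      · simp only [Finset.mul_sum]
        refine Finset.sum_congr rfl fun i _ => Finset.sum_congr rfl fun j _ => ?_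
        rw [integral_const_mul, stein_ij v lam v' hb, integral_const_mul,
          integral_sub (iH i j) (iG2 i j)]
        linear_combination (b / 2 * (∫ ω, GG (gaussPrior n v') rr b (QY (Yf lam ω))
          (fun x => (x i * x j) * (x i * x j)) ∂(PP n v)
          - ∫ ω, GG (gaussPrior n v') rr b (QY (Yf lam ω))
          (fun x => x i * x j) ^ 2 ∂(PP n v))) * vw i j
      · intro i j
        have e : ∀ x : Fin n → ℝ, x j * x i = x i * x j := fun x => mul_comm _ _
        simp only [e]
    rw [key]
    ring
  · exact (integrable_finsetSum _ fun i _ => integrable_finsetSum _ fun j _ => iS i j).const_mul _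
  · exact integrable_finsetSum _ fun i _ => integrable_finsetSum _ fun j _ => igG i j
  · exact (integrable_finsetSum _ fun i _ => integrable_finsetSum _ fun j _ => iH i j).const_mul _
  · exact (((integrable_finsetSum _ fun i _ => integrable_finsetSum _ fun j _ => iS i j).const_mul
      _).add (integrable_finsetSum _ fun i _ => integrable_finsetSum _ fun j _ =>
        igG i j)).const_mul _

end final

/-- The derivative of the mismatched free energy with respect to the
assumed SNR `λ'`:
`(d/dλ') f_n = (1/4)(1/n²) E[‖⟨x xᵀ⟩_{λ',σ'}‖_F² − √(λ/λ')⟨(sᵀx)²⟩_{λ',σ'}]`. -/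
theorem deriv_freeEnergy_assumedSNR (n : ℕ) (hn : 1 ≤ n) (sig sig' lam lam' : ℝ)
    (hsig : 0 < sig) (hsig' : 0 < sig') (hlam : 0 < lam) (hlam' : 0 < lam') :
    deriv (fun t => freeEnergy n sig sig' lam t) lam' =
      (1 / 4) * (1 / (n : ℝ) ^ 2) *
        ∫ p, (frobSq (gibbsMatrix n sig' lam' (obs n lam p.1 p.2)) -
            Real.sqrt (lam / lam') *
              gibbs n sig' lam' (obs n lam p.1 p.2)
                (fun x => (∑ i, p.1 i * x i) ^ 2))
          ∂((gaussPrior n (sig ^ 2)).prod (noiseMeasure n)) := by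
  have hn0 : (0 : ℝ) < n := by exact_mod_cast hn
  have hb : 0 < Real.sqrt (lam' / n) := Real.sqrt_pos.2 (by positivity)
  have hF : (fun t => freeEnergy n sig sig' lam t) =ᶠ[nhds lam'] fun t => -(1 / (n : ℝ)) *
      ∫ ω, Real.log (ZZ (gaussPrior n (sig' ^ 2)) rr (Real.sqrt (t / n)) (QY (Yf lam ω)))
        ∂(PP n (sig ^ 2)) := by
    filter_upwards [lt_mem_nhds hlam'] with t ht
    unfold freeEnergy
    simp only [partitionFn_eq sig' (le_of_lt ht)]
    rw [transfer (sig ^ 2) (fun p => Real.log (ZZ (gaussPrior n (sig' ^ 2)) rr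
      (Real.sqrt (t / n)) (QY (obs n lam p.1 p.2))))]
    · rfl
    · exact (meas_ZZ _ (obs_meas lam) _).log
  have hsq : HasDerivAt (fun t : ℝ => Real.sqrt (t / n))
      ((1 / (n : ℝ)) / (2 * Real.sqrt (lam' / n))) lam' :=
    ((hasDerivAt_id lam').div_const (n : ℝ)).sqrt (by simp; constructor <;> positivity)
  have hD := (((deriv_logZ (n := n) (sig ^ 2) lam (sig' ^ 2) hb).comp lam' hsq).const_mul
    (-(1 / (n : ℝ))))
  have hD' := (hD.congr_of_eventuallyEq hF).deriv
  rw [hD', mean_formula (sig ^ 2) lam (sig' ^ 2) hb]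
  have hR : ∫ p, (frobSq (gibbsMatrix n sig' lam' (obs n lam p.1 p.2)) -
            Real.sqrt (lam / lam') *
              gibbs n sig' lam' (obs n lam p.1 p.2)
                (fun x => (∑ i, p.1 i * x i) ^ 2))
          ∂((gaussPrior n (sig ^ 2)).prod (noiseMeasure n))
      = (∫ ω, ∑ i, ∑ j, GG (gaussPrior n (sig' ^ 2)) rr (Real.sqrt (lam' / n)) (QY (Yf lam ω))
          (fun x => x i * x j) ^ 2 ∂(PP n (sig ^ 2)))
        - Real.sqrt (lam / lam') * ∫ ω, ∑ i, ∑ j, (ω.1 i * ω.1 j) *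
          GG (gaussPrior n (sig' ^ 2)) rr (Real.sqrt (lam' / n)) (QY (Yf lam ω))
          (fun x => x i * x j) ∂(PP n (sig ^ 2)) := by
    simp only [frobSq, gibbsMatrix, Matrix.of_apply, gibbs_eq sig' hlam'.le, GG_square]
    rw [transfer (sig ^ 2) (fun p =>
      ∑ i, ∑ j, GG (gaussPrior n (sig' ^ 2)) rr (Real.sqrt (lam' / n)) (QY (obs n lam p.1 p.2))
          (fun x => x i * x j) ^ 2 - Real.sqrt (lam / lam') * ∑ i, ∑ j, (p.1 i * p.1 j) *
          GG (gaussPrior n (sig' ^ 2)) rr (Real.sqrt (lam' / n)) (QY (obs n lam p.1 p.2))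
          (fun x => x i * x j))]
    · rw [← integral_const_mul, ← integral_sub]
      · rfl
      · exact (Mom.sum _ fun i => Mom.sum _ fun j =>
          (mom_G (sig ^ 2) lam (sig' ^ 2) hb i j).pow 2).integrable
      · exact ((Mom.const _).mul (Mom.sum _ fun i => Mom.sum _ fun j =>
          ((mom_s (sig ^ 2) i).mul (mom_s (sig ^ 2) j)).mul
            (mom_G (sig ^ 2) lam (sig' ^ 2) hb i j))).integrable
    · have hm : ∀ i j, Measurable fun p : (Fin n → ℝ) × Matrix (Fin n) (Fin n) ℝ =>
          GG (gaussPrior n (sig' ^ 2)) rr (Real.sqrt (lam' / n)) (QY (obs n lam p.1 p.2))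
          (fun x => x i * x j) := fun i j => meas_GG _ (obs_meas lam) _
            (f := fun _ x => x i * x j) (by simp only [Function.uncurry_def]; fun_prop)
      fun_prop
  rw [hR]
  have hq : Real.sqrt (lam / lam') = Real.sqrt (lam / n) / Real.sqrt (lam' / n) := by
    rw [← Real.sqrt_div (by positivity)]
    congr 1
    field_simp
  rw [hq]
  field_simp
  ring

end
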